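/- arXiv:2110.09507 — 4 statements merged into one kernel-verified Lean document; each statement's English description precedes it below -/
import Mathlib

section
/- Let M be a finite-horizon MDP with initial state s0 and rewards in [0,1], and let (s,a) be a state-action pair that is α-important for M, i.e. the optimal value V^{M∖(s,a),*}_0(s0) of the modified MDP M∖(s,a) satisfies V^{M∖(s,a),*}_0(s0) < V^{M,*}_0(s0) − α. Then every policy π with V^{M,*}_0(s0) − V^{M,π}_0(s0) < ε for some ε with 0 ≤ ε < α satisfies P((s,a) ∈ τ_π) > (α − ε)/H. -/
open Finset

namespace MDPform

variable {S A : Type}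

/-- Probability that a deterministic nonstationary policy `π`, run from `s0` for `H` steps
in an MDP with (time-dependent) dynamics `P`, produces the state trajectory `τ`. -/
def trajProb [Fintype S] [DecidableEq S] (P : ℕ → S → A → S → ℝ) (π : ℕ → S → A)
    (s0 : S) (H : ℕ) (τ : Fin (H + 1) → S) : ℝ :=
  (if τ 0 = s0 then (1 : ℝ) else 0) *
    ∏ h : Fin H, P h (τ h.castSucc) (π h (τ h.castSucc)) (τ h.succ)

/-- Sum of rewards along a trajectory. -/
def ret (r : S → A → ℝ) (π : ℕ → S → A) (H : ℕ) (τ : Fin (H + 1) → S) : ℝ :=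
  ∑ h : Fin H, r (τ h.castSucc) (π h (τ h.castSucc))

/-- Value `V^{M,π}_0(s0)` of policy `π`. -/
def value [Fintype S] [DecidableEq S] (P : ℕ → S → A → S → ℝ) (r : S → A → ℝ)
    (π : ℕ → S → A) (s0 : S) (H : ℕ) : ℝ :=
  ∑ τ : Fin (H + 1) → S, trajProb P π s0 H τ * ret r π H τ

/-- Optimal value `V^{M,*}_0(s0)`. -/
noncomputable def optValue [Fintype S] [DecidableEq S] (P : ℕ → S → A → S → ℝ)
    (r : S → A → ℝ) (s0 : S) (H : ℕ) : ℝ :=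
  ⨆ π : ℕ → S → A, value P r π s0 H

/-- Probability of a set of trajectories. -/
noncomputable def probEvent [Fintype S] [DecidableEq S] (P : ℕ → S → A → S → ℝ)
    (π : ℕ → S → A) (s0 : S) (H : ℕ) (E : Set (Fin (H + 1) → S)) : ℝ :=
  ∑ τ : Fin (H + 1) → S, E.indicator (trajProb P π s0 H) τ

/-- Probability that the trajectory of `π` visits the state-action pair `(s,a)`. -/
noncomputable def visitProb [Fintype S] [DecidableEq S] (P : ℕ → S → A → S → ℝ)
    (π : ℕ → S → A) (s0 : S) (H : ℕ) (s : S) (a : A) : ℝ :=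
  probEvent P π s0 H {τ | ∃ h : Fin H, τ h.castSucc = s ∧ π h (τ h.castSucc) = a}

/-- A transition kernel is stochastic: nonnegative entries, rows summing to one. -/
def IsStochastic [Fintype S] (P : S → A → S → ℝ) : Prop :=
  (∀ s a s', 0 ≤ P s a s') ∧ ∀ s a, ∑ s' : S, P s a s' = 1

/-- The dynamics of `M∖(s,a)`: the terminal state `⊖` is modelled by `none`, is absorbing,
and taking action `a` at state `s` transitions deterministically to it. -/
def removeSA [DecidableEq S] [DecidableEq A] (P : S → A → S → ℝ) (s : S) (a : A) :
    Option S → A → Option S → ℝ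
  | none, _, y => if y = none then 1 else 0
  | some x, u, y =>
      if x = s ∧ u = a then (if y = none then 1 else 0)
      else Option.elim y 0 (fun y' => P x u y')

/-- Rewards lifted to `M∖(s,a)`: the terminal state carries zero reward. -/
def liftReward (r : S → A → ℝ) : Option S → A → ℝ
  | none, _ => 0
  | some x, u => r x u

/-- Backward-recursive value `V^{M,π}_h(s)` for time-dependent dynamics. -/
def Vpol [Fintype S] (P : ℕ → S → A → S → ℝ) (r : S → A → ℝ) (π : ℕ → S → A)
    (H : ℕ) (h : ℕ) (s : S) : ℝ :=
  if hlt : h < H then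
    r s (π h s) + ∑ s' : S, P h s (π h s) s' * Vpol P r π H (h + 1) s'
  else 0
termination_by H - h

lemma IsStochastic.le_one [Fintype S] {P : S → A → S → ℝ} (hP : IsStochastic P)
    (s : S) (a : A) (s' : S) : P s a s' ≤ 1 := by
  rw [← hP.2 s a]
  exact Finset.single_le_sum (f := P s a) (fun x _ => hP.1 s a x) (Finset.mem_univ s')

lemma ret_nonneg {r : S → A → ℝ} (hr : ∀ s a, r s a ∈ Set.Icc (0 : ℝ) 1)
    (π : ℕ → S → A) (H : ℕ) (τ : Fin (H + 1) → S) : 0 ≤ ret r π H τ :=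
  Finset.sum_nonneg fun _ _ => (hr _ _).1

lemma ret_le {r : S → A → ℝ} (hr : ∀ s a, r s a ∈ Set.Icc (0 : ℝ) 1)
    (π : ℕ → S → A) (H : ℕ) (τ : Fin (H + 1) → S) : ret r π H τ ≤ H := by
  simpa [ret] using
    Finset.sum_le_sum fun (h : Fin H) (_ : h ∈ Finset.univ) =>
      (hr (τ h.castSucc) (π h (τ h.castSucc))).2

section Trajectories

variable [Fintype S] [DecidableEq S]

lemma trajProb_nonneg {P : ℕ → S → A → S → ℝ} (hP : ∀ h s a s', 0 ≤ P h s a s')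
    (π : ℕ → S → A) (s0 : S) (H : ℕ) (τ : Fin (H + 1) → S) :
    0 ≤ trajProb P π s0 H τ := by
  unfold trajProb
  exact mul_nonneg (by split_ifs <;> norm_num) (Finset.prod_nonneg fun h _ => hP _ _ _ _)

lemma trajProb_le_one {P : ℕ → S → A → S → ℝ} (hP : ∀ h s a s', 0 ≤ P h s a s')
    (hP1 : ∀ h s a s', P h s a s' ≤ 1)
    (π : ℕ → S → A) (s0 : S) (H : ℕ) (τ : Fin (H + 1) → S) :
    trajProb P π s0 H τ ≤ 1 := by
  unfold trajProb
  exact mul_le_one₀ (by split_ifs <;> norm_num) (Finset.prod_nonneg fun h _ => hP _ _ _ _)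
    (Finset.prod_le_one (fun h _ => hP _ _ _ _) fun h _ => hP1 _ _ _ _)

lemma value_le_optValue {P : ℕ → S → A → S → ℝ} (hP : ∀ h s a s', 0 ≤ P h s a s')
    (hP1 : ∀ h s a s', P h s a s' ≤ 1) {r : S → A → ℝ}
    (hr : ∀ s a, r s a ∈ Set.Icc (0 : ℝ) 1) (π : ℕ → S → A) (s0 : S) (H : ℕ) :
    value P r π s0 H ≤ optValue P r s0 H := by
  refine le_ciSup (f := fun π => value P r π s0 H)
    ⟨∑ _τ : Fin (H + 1) → S, 1 * (H : ℝ), ?_⟩ π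
  rintro _ ⟨π', rfl⟩
  exact Finset.sum_le_sum fun τ _ => mul_le_mul (trajProb_le_one hP hP1 π' s0 H τ)
    (ret_le hr π' H τ) (ret_nonneg hr π' H τ) zero_le_one

end Trajectories

lemma liftReward_mem_Icc {r : S → A → ℝ} (hr : ∀ s a, r s a ∈ Set.Icc (0 : ℝ) 1)
    (x : Option S) (u : A) : liftReward r x u ∈ Set.Icc (0 : ℝ) 1 := by
  rcases x with _ | x
  · simp [liftReward]
  · exact hr x u

/-- Extension of a policy to the state space with a terminal state, where it plays `a`. -/
def liftPolicy (π : ℕ → S → A) (a : A) (h : ℕ) (x : Option S) : A :=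
  x.elim a (π h)

section RemoveSA

variable [DecidableEq S] [DecidableEq A]

lemma removeSA_nonneg {P : S → A → S → ℝ} (hP : ∀ s a s', 0 ≤ P s a s') (s : S) (a : A)
    (x : Option S) (u : A) (y : Option S) : 0 ≤ removeSA P s a x u y := by
  rcases x with _ | x <;> rcases y with _ | y <;> simp only [removeSA, Option.elim] <;>
    split_ifs <;> first | exact hP _ _ _ | norm_num

lemma removeSA_le_one {P : S → A → S → ℝ} (hP : ∀ s a s', P s a s' ≤ 1) (s : S) (a : A)
    (x : Option S) (u : A) (y : Option S) : removeSA P s a x u y ≤ 1 := by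
  rcases x with _ | x <;> rcases y with _ | y <;> simp only [removeSA, Option.elim] <;>
    split_ifs <;> first | exact hP _ _ _ | norm_num

lemma trajProb_removeSA_some [Fintype S] (P : S → A → S → ℝ) (π : ℕ → S → A) (s0 s : S) (a : A)
    (H : ℕ) (τ : Fin (H + 1) → S)
    (hτ : ¬ ∃ h : Fin H, τ h.castSucc = s ∧ π h (τ h.castSucc) = a) :
    trajProb (fun _ => removeSA P s a) (liftPolicy π a) (some s0) H (fun i => some (τ i)) =
      trajProb (fun _ => P) π s0 H τ := by
  push Not at hτ
  unfold trajProb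
  congr 1
  · simp
  · refine Finset.prod_congr rfl fun h _ => ?_
    simp only [removeSA, liftPolicy, Option.elim]
    exact if_neg fun hh => hτ h hh.1 hh.2

/-- Removing `(s, a)` costs a policy at most `H` times its probability of visiting `(s, a)`. -/
lemma value_le_value_removeSA_add [Fintype S] {P : S → A → S → ℝ}
    (hP : ∀ s a s', 0 ≤ P s a s') {r : S → A → ℝ} (hr : ∀ s a, r s a ∈ Set.Icc (0 : ℝ) 1)
    (π : ℕ → S → A) (s0 s : S) (a : A) (H : ℕ) :
    value (fun _ => P) r π s0 H ≤
      value (fun _ => removeSA P s a) (liftReward r) (liftPolicy π a) (some s0) H +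
        H * visitProb (fun _ => P) π s0 H s a := by
  have hnn := trajProb_nonneg (fun (_ : ℕ) => removeSA_nonneg hP s a) (liftPolicy π a) (some s0) H
  have hrn := ret_nonneg (liftReward_mem_Icc hr) (liftPolicy π a) H
  let e : (Fin (H + 1) → S) ↪ (Fin (H + 1) → Option S) :=
    ⟨fun τ i => some (τ i), fun τ τ' h => funext fun i => Option.some_injective _ (congrFun h i)⟩
  have hsub : ∑ τ, trajProb (fun _ => removeSA P s a) (liftPolicy π a) (some s0) H (e τ) *
        ret (liftReward r) (liftPolicy π a) H (e τ) ≤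
      value (fun _ => removeSA P s a) (liftReward r) (liftPolicy π a) (some s0) H := by
    rw [← Finset.sum_map Finset.univ e fun τ =>
      trajProb (fun _ => removeSA P s a) (liftPolicy π a) (some s0) H τ *
        ret (liftReward r) (liftPolicy π a) H τ]
    exact Finset.sum_le_univ_sum_of_nonneg fun τ => mul_nonneg (hnn τ) (hrn τ)
  refine le_trans ?_ (add_le_add_left hsub _)
  unfold value visitProb probEvent
  rw [Finset.mul_sum, ← Finset.sum_add_distrib]
  refine Finset.sum_le_sum fun τ _ => ?_
  have hτ0 := trajProb_nonneg (fun (_ : ℕ) => hP) π s0 H τ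
  by_cases hτ : ∃ h : Fin H, τ h.castSucc = s ∧ π h (τ h.castSucc) = a
  · rw [Set.indicator_of_mem (by exact hτ), mul_comm (H : ℝ)]
    have h1 := mul_le_mul_of_nonneg_left (ret_le hr π H τ) hτ0
    have h2 := mul_nonneg (hnn (e τ)) (hrn (e τ))
    linarith
  · rw [Set.indicator_of_notMem (by exact hτ), mul_zero, add_zero]
    exact le_of_eq (congrArg₂ (· * ·) (trajProb_removeSA_some P π s0 s a H τ hτ).symm rfl)

end RemoveSA

/-- If `(s,a)` is `α`-important for `M` (the optimal value of `M∖(s,a)` is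
below `V^{M,*}_0(s0) - α`), then any policy `π` that is `ε`-suboptimal for some
`0 ≤ ε < α` visits `(s,a)` with probability greater than `(α - ε)/H`. -/
theorem importance_implies_visitation
    {S A : Type} [Fintype S] [DecidableEq S] [Nonempty S]
    [Fintype A] [DecidableEq A] [Nonempty A]
    (P : S → A → S → ℝ) (hP : IsStochastic P)
    (r : S → A → ℝ) (hr : ∀ s a, r s a ∈ Set.Icc (0 : ℝ) 1)
    (H : ℕ) (s0 s : S) (a : A) (α : ℝ)
    (himp : optValue (fun _ => removeSA P s a) (liftReward r) (some s0) H <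
      optValue (fun _ => P) r s0 H - α)
    (π : ℕ → S → A) (ε : ℝ) (hε0 : 0 ≤ ε) (hεα : ε < α)
    (hπ : optValue (fun _ => P) r s0 H - value (fun _ => P) r π s0 H < ε) :
    (α - ε) / H < visitProb (fun _ => P) π s0 H s a := by
  have hval := value_le_value_removeSA_add hP.1 hr π s0 s a H
  have hopt := value_le_optValue (fun (_ : ℕ) => removeSA_nonneg hP.1 s a)
    (fun _ => removeSA_le_one hP.le_one s a) (liftReward_mem_Icc hr) (liftPolicy π a) (some s0) H
  have hlt : α - ε < H * visitProb (fun _ => P) π s0 H s a := by linarith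
  have hH : (0 : ℝ) < H := by
    refine lt_of_le_of_ne (Nat.cast_nonneg H) fun h => ?_
    rw [← h, zero_mul] at hlt
    linarith
  rwa [div_lt_iff₀' hH]

end MDPform
end

section
/- (Performance difference lemma.) Fix two finite-horizon MDPs M=(S,A,P,r,H) and M'=(S,A,P',r,H) with the same states, actions, rewards, horizon and initial state s0, and possibly time-dependent dynamics P_h, P'_h. Then for any policy π, V^{M',π}_0(s0) − V^{M,π}_0(s0) = E_{M,π}[ Σ_{h=0}^{H−1} ((P'_h − P_h) V^{M',π}_{h+1})(s_h, a_h) | s_0 = s0 ], where for any function f : S → ℝ, (P_h f)(s,a) = Σ_{s'} P_h(s'|s,a) f(s'), and the expectation is over the trajectory of π in M. -/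
open Finset

namespace MDPform

variable {S A : Type}

/-- First-step decomposition of the expectation over trajectories. -/
theorem sum_trajProb_succ [Fintype S] [DecidableEq S] (P : ℕ → S → A → S → ℝ) (π : ℕ → S → A)
    (s0 : S) (H : ℕ) (f : (Fin (H + 2) → S) → ℝ) :
    ∑ τ, trajProb P π s0 (H + 1) τ * f τ =
      ∑ s', P 0 s0 (π 0 s0) s' *
        ∑ τ, trajProb (fun h => P (h + 1)) (fun h => π (h + 1)) s' H τ *
          f (Fin.cons s0 τ : Fin (H + 2) → S) := by
  rw [← (Fin.consEquiv fun _ : Fin (H + 2) => S).sum_comp, Fintype.sum_prod_type,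
    Finset.sum_eq_single s0]
  · simp_rw [Finset.mul_sum]
    rw [Finset.sum_comm]
    refine Finset.sum_congr rfl fun τ _ => ?_
    rw [Finset.sum_eq_single (τ 0)]
    · simp [trajProb, Fin.consEquiv, Fin.prod_univ_succ, mul_assoc]
    · intro s' _ hs
      simp [trajProb, hs.symm]
    · simp
  · intro s _ hs
    simp [trajProb, Fin.consEquiv, hs]
  · simp

/-- Trajectory probabilities sum to one. -/
theorem sum_trajProb [Fintype S] [DecidableEq S] (P : ℕ → S → A → S → ℝ)
    (hP : ∀ h s a, ∑ s', P h s a s' = 1) (π : ℕ → S → A) (s0 : S) (H : ℕ) :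
    ∑ τ, trajProb P π s0 H τ = 1 := by
  induction H generalizing P π s0 with
  | zero =>
    rw [← (Equiv.funUnique (Fin 1) S).symm.sum_comp]
    simp [trajProb]
  | succ H ih =>
    have h := sum_trajProb_succ P π s0 H fun _ => 1
    simp only [mul_one] at h
    simp [h, ih _ (fun h => hP (h + 1)), hP]

/-- The expected sum of one-step Bellman residuals of `D` along a trajectory telescopes to
`D 0 s0` when `D` vanishes at the horizon. -/
theorem sum_trajProb_mul_residual [Fintype S] [DecidableEq S] (P : ℕ → S → A → S → ℝ)
    (hP : ∀ h s a, ∑ s', P h s a s' = 1) (π : ℕ → S → A) (s0 : S) (H : ℕ) (D : ℕ → S → ℝ)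
    (hD : ∀ s, D H s = 0) :
    ∑ τ, trajProb P π s0 H τ * ∑ h : Fin H, (D h (τ h.castSucc) -
      ∑ s', P h (τ h.castSucc) (π h (τ h.castSucc)) s' * D (h + 1) s') = D 0 s0 := by
  induction H generalizing P π s0 D with
  | zero => simp [hD]
  | succ H ih =>
    have ih' := fun s' => ih (fun h => P (h + 1)) (fun h => hP (h + 1)) (fun h => π (h + 1)) s'
      (fun h => D (h + 1)) hD
    rw [sum_trajProb_succ]
    simp only [Fin.sum_univ_succ, mul_add, Finset.sum_add_distrib, Fin.castSucc_zero,
      Fin.cons_zero, ← Fin.succ_castSucc, Fin.cons_succ, Fin.val_succ, Fin.val_zero, zero_add,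
      ih', ← Finset.sum_mul, sum_trajProb _ (fun h => hP (h + 1)), one_mul, hP, sub_add_cancel]

/-- **performance difference lemma.** For two MDPs sharing states, actions,
rewards, horizon and initial state,
`V^{M',π}_0(s0) − V^{M,π}_0(s0)
  = E_{M,π}[ Σ_{h<H} ((P'_h − P_h) V^{M',π}_{h+1})(s_h, a_h) ]`,
where the expectation is over the trajectory of `π` in `M`. -/
theorem performance_difference
    {S A : Type} [Fintype S] [DecidableEq S] [Nonempty S]
    [Fintype A] [DecidableEq A] [Nonempty A]
    (P P' : ℕ → S → A → S → ℝ) (hP : ∀ h, IsStochastic (P h)) (hP' : ∀ h, IsStochastic (P' h))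
    (r : S → A → ℝ) (hr : ∀ s a, r s a ∈ Set.Icc (0 : ℝ) 1)
    (H : ℕ) (s0 : S) (π : ℕ → S → A) :
    Vpol P' r π H 0 s0 - Vpol P r π H 0 s0 =
      ∑ τ : Fin (H + 1) → S, trajProb P π s0 H τ *
        ∑ h : Fin H, ∑ s' : S,
          (P' h (τ h.castSucc) (π h (τ h.castSucc)) s' -
            P h (τ h.castSucc) (π h (τ h.castSucc)) s') * Vpol P' r π H ((h : ℕ) + 1) s' := by
  have key := sum_trajProb_mul_residual P (fun h => (hP h).2) π s0 H
    (fun h s => Vpol P' r π H h s - Vpol P r π H h s) (fun s => by simp [Vpol])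
  rw [← key]
  refine Finset.sum_congr rfl fun τ _ => congrArg _ (Finset.sum_congr rfl fun h _ => ?_)
  rw [Vpol.eq_1 P' r π H h, Vpol.eq_1 P r π H h, dif_pos h.isLt, dif_pos h.isLt]
  simp only [sub_mul, mul_sub, Finset.sum_sub_distrib]
  ring

end MDPform
end

section
/- (Optimism of value iteration with optimistic borrowing across tasks.) Let S and A be finite sets, let r : S×A → ℝ be nonnegative, let H ∈ ℕ, let P̂_0, P̂_1, …, P̂_T : S×A → (S → ℝ≥0) be sub-stochastic kernels (Σ_{s'} P̂_k(s'|s,a) ≤ 1 for all k, s, a), let E ⊆ S×A, and fix t ∈ {1,…,T}. Define the backward recursion V̂_H ≡ 0, Q̂_h(s,a) = r(s,a) + (P̂_t V̂_{h+1})(s,a) if (s,a) ∈ E and Q̂_h(s,a) = r(s,a) + max_{k∈{0,…,T}} (P̂_k V̂_{h+1})(s,a) otherwise, and V̂_h(s) = max_a Q̂_h(s,a). Call an index function I : S×A×{0,…,H−1} → {0,…,T} admissible if I(s,a,h) = t whenever (s,a) ∈ E, and for such I define V̂^I by the same recursion with Q̂^I_h(s,a) = r(s,a) + (P̂_{I(s,a,h)}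 V̂^I_{h+1})(s,a). Then V̂_h(s) ≥ V̂^I_h(s) for every admissible I, every h and every s, and there exists an admissible index function I* with V̂ = V̂^{I*}; in particular V̂_0(s0) = max over admissible I of V̂^I_0(s0) for any s0 ∈ S. -/
open Finset

namespace BOATVI

variable {S A : Type}

/-- The BOAT-VI value function `V̂_h`: backward value iteration where on pairs in `E` the
kernel `P̂_t` is used, and on all other pairs the Bellman backup optimistically maximizes
over all kernels `P̂_0, …, P̂_T`.  `V̂_h = 0` for `h ≥ H`. -/
noncomputable def boatV [Fintype S] [Fintype A] [Nonempty A] {T : ℕ}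
    (Phat : Fin (T + 1) → S → A → S → ℝ) (r : S → A → ℝ)
    (E : Set (S × A)) [DecidablePred (· ∈ E)] (t : Fin (T + 1)) (H : ℕ) (h : ℕ) (s : S) : ℝ :=
  if _ : h < H then
    ⨆ a : A, (r s a +
      if (s, a) ∈ E then ∑ s' : S, Phat t s a s' * boatV Phat r E t H (h + 1) s'
      else ⨆ k : Fin (T + 1), ∑ s' : S, Phat k s a s' * boatV Phat r E t H (h + 1) s')
  else 0
termination_by H - h

/-- The value function `V̂^I_h` obtained by performing the same backward recursion but with
the kernel at `(s,a)` at step `h` chosen by the index function `I`. -/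
noncomputable def idxV [Fintype S] [Fintype A] [Nonempty A] {T : ℕ}
    (Phat : Fin (T + 1) → S → A → S → ℝ) (r : S → A → ℝ)
    (I : S → A → ℕ → Fin (T + 1)) (H : ℕ) (h : ℕ) (s : S) : ℝ :=
  if _ : h < H then
    ⨆ a : A, (r s a + ∑ s' : S, Phat (I s a h) s a s' * idxV Phat r I H (h + 1) s')
  else 0
termination_by H - h

/-- An index function is admissible if it selects kernel `t` on every pair of `E`. -/
def Admissible {T : ℕ} (E : Set (S × A)) (t : Fin (T + 1))
    (I : S → A → ℕ → Fin (T + 1)) : Prop :=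
  ∀ s a h, (s, a) ∈ E → I s a h = t

section Optimism

variable [Fintype S] [Fintype A] [Nonempty A] {T : ℕ}
  {Phat : Fin (T + 1) → S → A → S → ℝ} {r : S → A → ℝ}
  {E : Set (S × A)} [DecidablePred (· ∈ E)] {t : Fin (T + 1)}
  {I : S → A → ℕ → Fin (T + 1)}

theorem idxV_le_boatV (hP : ∀ k s a s', 0 ≤ Phat k s a s') (hI : Admissible E t I)
    (H h : ℕ) (s : S) : idxV Phat r I H h s ≤ boatV Phat r E t H h s := by
  by_cases hh : h < H
  · have ih (s' : S) : idxV Phat r I H (h + 1) s' ≤ boatV Phat r E t H (h + 1) s' :=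
      idxV_le_boatV hP hI H (h + 1) s'
    rw [idxV, boatV, dif_pos hh, dif_pos hh]
    refine ciSup_mono (Set.finite_range _).bddAbove fun a => ?_
    gcongr
    have step : ∑ s', Phat (I s a h) s a s' * idxV Phat r I H (h + 1) s' ≤
        ∑ s', Phat (I s a h) s a s' * boatV Phat r E t H (h + 1) s' :=
      Finset.sum_le_sum fun s' _ => mul_le_mul_of_nonneg_left (ih s') (hP _ s a s')
    split_ifs with hE
    · rwa [hI s a h hE] at step ⊢
    · exact step.trans (le_ciSup
        (f := fun k => ∑ s', Phat k s a s' * boatV Phat r E t H (h + 1) s')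
        (Set.finite_range _).bddAbove (I s a h))
  · rw [idxV, boatV, dif_neg hh, dif_neg hh]
termination_by H - h

theorem boatV_eq_idxV {H : ℕ} (hI : Admissible E t I)
    (hmax : ∀ s a h, (s, a) ∉ E →
      ∑ s', Phat (I s a h) s a s' * boatV Phat r E t H (h + 1) s' =
        ⨆ k, ∑ s', Phat k s a s' * boatV Phat r E t H (h + 1) s')
    (h : ℕ) (s : S) : boatV Phat r E t H h s = idxV Phat r I H h s := by
  by_cases hh : h < H
  · have ih (s' : S) := boatV_eq_idxV hI hmax (h + 1) s'
    rw [idxV, boatV, dif_pos hh, dif_pos hh]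
    refine iSup_congr fun a => ?_
    simp only [← ih]
    split_ifs with hE
    · rw [hI s a h hE]
    · rw [hmax s a h hE]
  · rw [idxV, boatV, dif_neg hh, dif_neg hh]
termination_by H - h

variable (Phat r E t) in
theorem exists_admissible_boatV_eq_idxV (H : ℕ) :
    ∃ I : S → A → ℕ → Fin (T + 1), Admissible E t I ∧
      ∀ h s, boatV Phat r E t H h s = idxV Phat r I H h s := by
  choose J hJ using fun (s : S) (a : A) (h : ℕ) => exists_eq_ciSup_of_finite
    (f := fun k => ∑ s', Phat k s a s' * boatV Phat r E t H (h + 1) s')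
  have hI : Admissible E t fun s a h => if (s, a) ∈ E then t else J s a h :=
    fun s a h hE => if_pos hE
  refine ⟨_, hI, boatV_eq_idxV hI fun s a h hE => ?_⟩
  simpa only [if_neg hE] using hJ s a h

end Optimism

/-- **optimism of BOAT-VI.** With nonnegative rewards and sub-stochastic
kernels, `V̂` dominates `V̂^I` for every admissible index function `I`, is itself realized
by an admissible index function, and hence `V̂_0(s0)` is the maximum of `V̂^I_0(s0)` over
admissible `I`. -/
theorem boatV_optimism
    {S A : Type} [Fintype S] [Nonempty S] [Fintype A] [Nonempty A]
    {T : ℕ} (Phat : Fin (T + 1) → S → A → S → ℝ)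
    (hsub : ∀ k s a, (∀ s', 0 ≤ Phat k s a s') ∧ ∑ s' : S, Phat k s a s' ≤ 1)
    (r : S → A → ℝ) (hr : ∀ s a, 0 ≤ r s a)
    (E : Set (S × A)) [DecidablePred (· ∈ E)] (t : Fin (T + 1)) (ht : t ≠ 0) (H : ℕ) :
    (∀ I : S → A → ℕ → Fin (T + 1), Admissible E t I →
      ∀ h s, idxV Phat r I H h s ≤ boatV Phat r E t H h s) ∧
    (∃ I : S → A → ℕ → Fin (T + 1), Admissible E t I ∧
      ∀ h s, boatV Phat r E t H h s = idxV Phat r I H h s) ∧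
    (∀ s0 : S, boatV Phat r E t H 0 s0 =
      ⨆ I : {I : S → A → ℕ → Fin (T + 1) // Admissible E t I},
        idxV Phat r I.1 H 0 s0) := by
  have hle (I : S → A → ℕ → Fin (T + 1)) (hI : Admissible E t I) (h : ℕ) (s : S) :
      idxV Phat r I H h s ≤ boatV Phat r E t H h s :=
    idxV_le_boatV (fun k s a => (hsub k s a).1) hI H h s
  obtain ⟨I, hI, hV⟩ := exists_admissible_boatV_eq_idxV Phat r E t H
  refine ⟨hle, ⟨I, hI, hV⟩, fun s0 => le_antisymm ?_ ?_⟩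
  · rw [hV]
    exact le_ciSup (f := fun I : {I // Admissible E t I} => idxV Phat r I.1 H 0 s0)
      ⟨boatV Phat r E t H 0 s0, by rintro _ ⟨J, rfl⟩; exact hle J.1 J.2 0 s0⟩ ⟨I, hI⟩
  · have : Nonempty {I : S → A → ℕ → Fin (T + 1) // Admissible E t I} := ⟨⟨I, hI⟩⟩
    exact ciSup_le fun J => hle J.1 J.2 0 s0

end BOATVI
end

section
/- (Dynamics estimation error bound.) There is a universal constant c > 0 such that the following holds. Fix a policy π, a finite-horizon MDP M=(S,A,P,r,H) with stationary dynamics and initial state s0, and N ∈ ℕ. Suppose π is played for N independent episodes in M and all HN observed transitions (s_h, a_h, s_{h+1}) are collected; for each pair (s,a) let N(s,a) be the number of collected transitions from (s,a) and let P̂(·|s,a) be the empirical distribution of the observed next states from (s,a). Then for any p ∈ (0,1), with probability at least 1 − p, every pair (s,a) with N(s,a) > 0 satisfies sup over f : S → [0,H] of |((P̂ − P) f)(s,a)| ≤ c·( √( (H² S / N(s,a)) · log(SAHN/p) ) + (HS / N(s,a)) · log(SAHN/p) ), where S = |S| and A = |A|. -/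
open Finset

namespace MDPform

variable {S A : Type}

/-- Number of visits to the state-action pair `(s,a)` in `N` episodes `ω` of horizon `H`. -/
def countSA [DecidableEq S] [DecidableEq A] (π : ℕ → S → A) (H N : ℕ)
    (ω : Fin N → Fin (H + 1) → S) (s : S) (a : A) : ℕ :=
  ∑ n : Fin N, ∑ h : Fin H,
    if ω n h.castSucc = s ∧ π h (ω n h.castSucc) = a then 1 else 0

/-- Number of observed transitions `(s,a) → s'` in `N` episodes `ω` of horizon `H`. -/
def countTrans [DecidableEq S] [DecidableEq A] (π : ℕ → S → A) (H N : ℕ)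
    (ω : Fin N → Fin (H + 1) → S) (s : S) (a : A) (s' : S) : ℕ :=
  ∑ n : Fin N, ∑ h : Fin H,
    if ω n h.castSucc = s ∧ π h (ω n h.castSucc) = a ∧ ω n h.succ = s' then 1 else 0

/-- Empirical transition kernel formed from `N` episodes `ω`. -/
noncomputable def empKernel [DecidableEq S] [DecidableEq A] (π : ℕ → S → A) (H N : ℕ)
    (ω : Fin N → Fin (H + 1) → S) (s : S) (a : A) (s' : S) : ℝ :=
  (countTrans π H N ω s a s' : ℝ) / (countSA π H N ω s a : ℝ)

/-- Probability of a set of tuples of `N` i.i.d. episodes of `π` in the MDP with stationary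
dynamics `P` started from `s0`. -/
noncomputable def episodesProb [Fintype S] [DecidableEq S] (P : S → A → S → ℝ)
    (π : ℕ → S → A) (s0 : S) (H N : ℕ) (E : Set (Fin N → Fin (H + 1) → S)) : ℝ :=
  ∑ ω : Fin N → Fin (H + 1) → S,
    E.indicator (fun ω => ∏ n : Fin N, trajProb (fun _ => P) π s0 H (ω n)) ω

/-- The weight of a trajectory under arbitrary (unnormalised) step kernels `K`. -/
def chainWeight [DecidableEq S] (K : ℕ → S → S → ℝ) (s0 : S) (H : ℕ)
    (τ : Fin (H + 1) → S) : ℝ :=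
  (if τ 0 = s0 then (1 : ℝ) else 0) * ∏ h : Fin H, K h (τ h.castSucc) (τ h.succ)

lemma chainWeight_nonneg [DecidableEq S] {K : ℕ → S → S → ℝ} (hK : ∀ h x y, 0 ≤ K h x y)
    (s0 : S) (H : ℕ) (τ : Fin (H + 1) → S) : 0 ≤ chainWeight K s0 H τ :=
  mul_nonneg (by split_ifs <;> norm_num) (prod_nonneg fun _ _ => hK _ _ _)

lemma sum_chainWeight_zero [Fintype S] [DecidableEq S] (K : ℕ → S → S → ℝ) (s0 : S) :
    ∑ τ : Fin (0 + 1) → S, chainWeight K s0 0 τ = 1 := by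
  rw [← (Equiv.funUnique (Fin 1) S).symm.sum_comp]
  simp [chainWeight]

lemma sum_chainWeight_succ [Fintype S] [DecidableEq S] (K : ℕ → S → S → ℝ) (s0 : S) (H : ℕ) :
    ∑ τ : Fin (H + 1 + 1) → S, chainWeight K s0 (H + 1) τ =
      ∑ τ : Fin (H + 1) → S, chainWeight K s0 H τ * ∑ y, K H (τ (Fin.last H)) y := by
  rw [← (Fin.snocEquiv fun _ : Fin (H + 1 + 1) => S).sum_comp, Fintype.sum_prod_type,
    sum_comm]
  refine sum_congr rfl fun τ _ => ?_
  rw [mul_sum]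
  refine sum_congr rfl fun y _ => ?_
  have h0 : (Fin.snoc τ y : Fin (H + 1 + 1) → S) 0 = τ 0 :=
    Fin.snoc_castSucc (α := fun _ => S) y τ 0
  have hc (i : Fin (H + 1)) : (Fin.snoc τ y : Fin (H + 1 + 1) → S) i.castSucc = τ i :=
    Fin.snoc_castSucc (α := fun _ => S) y τ i
  have hs (i : Fin H) : (Fin.snoc τ y : Fin (H + 1 + 1) → S) i.castSucc.succ = τ i.succ := by
    rw [Fin.succ_castSucc, hc]
  have hl : (Fin.snoc τ y : Fin (H + 1 + 1) → S) (Fin.last H).succ = y := by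
    rw [Fin.succ_last]
    exact Fin.snoc_last (α := fun _ => S) y τ
  simp only [chainWeight, Fin.snocEquiv_apply, Fin.prod_univ_castSucc, h0, hc, hs, hl,
    Fin.val_castSucc, Fin.val_last]
  ring

lemma sum_chainWeight_le_one [Fintype S] [DecidableEq S] {K : ℕ → S → S → ℝ}
    (hK : ∀ h x y, 0 ≤ K h x y) (hrow : ∀ h x, ∑ y, K h x y ≤ 1) (s0 : S) (H : ℕ) :
    ∑ τ : Fin (H + 1) → S, chainWeight K s0 H τ ≤ 1 := by
  induction H with
  | zero => exact (sum_chainWeight_zero K s0).le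
  | succ H ih =>
    rw [sum_chainWeight_succ]
    exact (sum_le_sum fun τ _ =>
      mul_le_of_le_one_right (chainWeight_nonneg hK s0 H τ) (hrow _ _)).trans ih

lemma sum_chainWeight_eq_one [Fintype S] [DecidableEq S] {K : ℕ → S → S → ℝ}
    (hrow : ∀ h x, ∑ y, K h x y = 1) (s0 : S) (H : ℕ) :
    ∑ τ : Fin (H + 1) → S, chainWeight K s0 H τ = 1 := by
  induction H with
  | zero => exact sum_chainWeight_zero K s0
  | succ H ih => simp only [sum_chainWeight_succ, hrow, mul_one, ih]

/-- The weight of a tuple of independent episodes. -/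
def episodesWeight [Fintype S] [DecidableEq S] (P : S → A → S → ℝ) (π : ℕ → S → A)
    (s0 : S) (H N : ℕ) (ω : Fin N → Fin (H + 1) → S) : ℝ :=
  ∏ n : Fin N, trajProb (fun _ => P) π s0 H (ω n)

lemma trajProb_eq_chainWeight [Fintype S] [DecidableEq S] (P : ℕ → S → A → S → ℝ)
    (π : ℕ → S → A) (s0 : S) (H : ℕ) (τ : Fin (H + 1) → S) :
    trajProb P π s0 H τ = chainWeight (fun h x y => P h x (π h x) y) s0 H τ := rfl

lemma episodesWeight_nonneg [Fintype S] [DecidableEq S] {P : S → A → S → ℝ}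
    (hP : IsStochastic P) (π : ℕ → S → A) (s0 : S) (H N : ℕ) (ω : Fin N → Fin (H + 1) → S) :
    0 ≤ episodesWeight P π s0 H N ω :=
  prod_nonneg fun n _ => chainWeight_nonneg (K := fun h x y => P x (π h x) y)
    (fun _ _ _ => hP.1 _ _ _) s0 H (ω n)

lemma sum_episodesWeight [Fintype S] [DecidableEq S] {P : S → A → S → ℝ}
    (hP : IsStochastic P) (π : ℕ → S → A) (s0 : S) (H N : ℕ) :
    ∑ ω, episodesWeight P π s0 H N ω = 1 := by
  simp only [episodesWeight]
  rw [← Fintype.prod_sum fun (_ : Fin N) τ => trajProb (fun _ => P) π s0 H τ]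
  refine prod_eq_one fun n _ => ?_
  simp only [trajProb_eq_chainWeight]
  exact sum_chainWeight_eq_one (fun _ _ => hP.2 _ _) s0 H

/-- One factor of the exponential supermartingale attached to the pair `(s, a)` and the
test function `g`. -/
noncomputable def expStep [Fintype S] [DecidableEq S] [DecidableEq A] (P : S → A → S → ℝ)
    (s : S) (a : A) (g : S → ℝ) (l : ℝ) (x : S) (u : A) (y : S) : ℝ :=
  if x = s ∧ u = a then Real.exp (l * (g y - ∑ z, P s a z * g z) - 4 * l ^ 2) else 1

lemma sum_mul_expStep_le_one [Fintype S] [DecidableEq S] [DecidableEq A] {P : S → A → S → ℝ}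
    (hP : IsStochastic P) (s : S) (a : A) {g : S → ℝ} (hg : ∀ x, |g x| ≤ 1) {l : ℝ}
    (hl0 : 0 ≤ l) (hl : l ≤ 1 / 2) (x : S) (u : A) :
    ∑ y, P x u y * expStep P s a g l x u y ≤ 1 := by
  by_cases h : x = s ∧ u = a
  · obtain ⟨rfl, rfl⟩ := h
    simp only [expStep, and_self, if_true]
    set m := ∑ z, P x u z * g z with hm
    have hm1 : |m| ≤ 1 := by
      refine (abs_sum_le_sum_abs _ _).trans ?_
      rw [← hP.2 x u]
      refine sum_le_sum fun z _ => ?_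
      rw [abs_mul, abs_of_nonneg (hP.1 _ _ _)]
      exact mul_le_of_le_one_right (hP.1 _ _ _) (hg z)
    have key (y : S) : Real.exp (l * (g y - m)) ≤ 1 + l * (g y - m) + 4 * l ^ 2 := by
      have h2 : |g y - m| ≤ 2 := (abs_sub _ _).trans (by linarith [hg y])
      have h3 : |l * (g y - m)| ≤ 1 := by
        rw [abs_mul, abs_of_nonneg hl0]
        nlinarith [abs_nonneg (g y - m)]
      have h4 := (abs_le.1 (Real.abs_exp_sub_one_sub_id_le h3)).2
      have h5 : (g y - m) ^ 2 ≤ 2 ^ 2 := sq_le_sq' (abs_le.1 h2).1 (abs_le.1 h2).2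
      nlinarith [sq_nonneg l]
    have hsum : ∑ y, P x u y * Real.exp (l * (g y - m)) ≤ 1 + 4 * l ^ 2 := by
      calc ∑ y, P x u y * Real.exp (l * (g y - m))
          ≤ ∑ y, P x u y * (1 + l * (g y - m) + 4 * l ^ 2) :=
            sum_le_sum fun y _ => mul_le_mul_of_nonneg_left (key y) (hP.1 _ _ _)
        _ = ∑ y, ((1 - l * m + 4 * l ^ 2) * P x u y + l * (P x u y * g y)) :=
            sum_congr rfl fun y _ => by ring
        _ = 1 + 4 * l ^ 2 := by
            rw [sum_add_distrib, ← mul_sum, ← mul_sum, hP.2, ← hm]; ring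
    calc ∑ y, P x u y * Real.exp (l * (g y - m) - 4 * l ^ 2)
        = (∑ y, P x u y * Real.exp (l * (g y - m))) * Real.exp (-(4 * l ^ 2)) := by
          rw [sum_mul]
          exact sum_congr rfl fun y _ => by rw [sub_eq_add_neg, Real.exp_add]; ring
      _ ≤ Real.exp (4 * l ^ 2) * Real.exp (-(4 * l ^ 2)) := by
          gcongr
          linarith [Real.add_one_le_exp (4 * l ^ 2)]
      _ = 1 := by rw [← Real.exp_add]; simp
  · simp only [expStep, h, if_false, mul_one, hP.2, le_refl]

lemma expStep_pos [Fintype S] [DecidableEq S] [DecidableEq A] (P : S → A → S → ℝ)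
    (s : S) (a : A) (g : S → ℝ) (l : ℝ) (x : S) (u : A) (y : S) :
    0 < expStep P s a g l x u y := by
  unfold expStep
  split_ifs
  · exact Real.exp_pos _
  · exact one_pos

/-- The exponential supermartingale at the end of `N` episodes. -/
noncomputable def expWeight [Fintype S] [DecidableEq S] [DecidableEq A] (P : S → A → S → ℝ)
    (π : ℕ → S → A) (H N : ℕ) (s : S) (a : A) (g : S → ℝ) (l : ℝ)
    (ω : Fin N → Fin (H + 1) → S) : ℝ :=
  ∏ n : Fin N, ∏ h : Fin H,
    expStep P s a g l (ω n h.castSucc) (π h (ω n h.castSucc)) (ω n h.succ)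

lemma expWeight_nonneg [Fintype S] [DecidableEq S] [DecidableEq A] (P : S → A → S → ℝ)
    (π : ℕ → S → A) (H N : ℕ) (s : S) (a : A) (g : S → ℝ) (l : ℝ)
    (ω : Fin N → Fin (H + 1) → S) : 0 ≤ expWeight P π H N s a g l ω :=
  prod_nonneg fun _ _ => prod_nonneg fun _ _ => (expStep_pos _ _ _ _ _ _ _ _).le

lemma sum_episodesWeight_mul_expWeight_le_one [Fintype S] [DecidableEq S] [DecidableEq A]
    {P : S → A → S → ℝ} (hP : IsStochastic P) (π : ℕ → S → A) (s0 : S) (H N : ℕ) (s : S) (a : A)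
    {g : S → ℝ} (hg : ∀ x, |g x| ≤ 1) {l : ℝ} (hl0 : 0 ≤ l) (hl : l ≤ 1 / 2) :
    ∑ ω, episodesWeight P π s0 H N ω * expWeight P π H N s a g l ω ≤ 1 := by
  let K : ℕ → S → S → ℝ := fun h x y => P x (π h x) y * expStep P s a g l x (π h x) y
  have hK : ∀ h x y, 0 ≤ K h x y := fun h x y =>
    mul_nonneg (hP.1 _ _ _) (expStep_pos _ _ _ _ _ _ _ _).le
  have heq (ω : Fin N → Fin (H + 1) → S) :
      episodesWeight P π s0 H N ω * expWeight P π H N s a g l ω =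
        ∏ n, chainWeight K s0 H (ω n) := by
    simp only [episodesWeight, expWeight, ← prod_mul_distrib, trajProb, chainWeight, mul_assoc, K]
  simp only [heq]
  rw [← Fintype.prod_sum fun (_ : Fin N) τ => chainWeight K s0 H τ]
  exact prod_le_one (fun n _ => sum_nonneg fun τ _ => chainWeight_nonneg hK s0 H τ)
    fun n _ => sum_chainWeight_le_one hK
      (fun h x => sum_mul_expStep_le_one hP s a hg hl0 hl x (π h x)) s0 H

lemma sum_countTrans_mul [Fintype S] [DecidableEq S] [DecidableEq A] (π : ℕ → S → A) (H N : ℕ)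
    (ω : Fin N → Fin (H + 1) → S) (s : S) (a : A) (g : S → ℝ) :
    ∑ s', (countTrans π H N ω s a s' : ℝ) * g s' =
      ∑ n : Fin N, ∑ h : Fin H,
        if ω n h.castSucc = s ∧ π h (ω n h.castSucc) = a then g (ω n h.succ) else 0 := by
  simp only [countTrans, Nat.cast_sum, sum_mul]
  rw [sum_comm]
  refine sum_congr rfl fun n _ => ?_
  rw [sum_comm]
  refine sum_congr rfl fun h _ => ?_
  by_cases hc : ω n h.castSucc = s ∧ π h (ω n h.castSucc) = a
  · obtain ⟨h1, h2⟩ := hc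
    rw [h1] at h2
    simp [h1, h2]
  · rw [if_neg hc]
    refine sum_eq_zero fun y _ => ?_
    rw [if_neg fun h' => hc ⟨h'.1, h'.2.1⟩]
    simp

lemma sum_countTrans [Fintype S] [DecidableEq S] [DecidableEq A] (π : ℕ → S → A) (H N : ℕ)
    (ω : Fin N → Fin (H + 1) → S) (s : S) (a : A) :
    ∑ s', (countTrans π H N ω s a s' : ℝ) = countSA π H N ω s a := by
  have := sum_countTrans_mul π H N ω s a fun _ => 1
  simp only [mul_one] at this
  rw [this]
  simp [countSA]

lemma countSA_le [DecidableEq S] [DecidableEq A] (π : ℕ → S → A) (H N : ℕ)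
    (ω : Fin N → Fin (H + 1) → S) (s : S) (a : A) : countSA π H N ω s a ≤ H * N := by
  calc countSA π H N ω s a ≤ ∑ _n : Fin N, ∑ _h : Fin H, 1 :=
        sum_le_sum fun n _ => sum_le_sum fun h _ => by split_ifs <;> simp
    _ = H * N := by simp [mul_comm]

lemma expWeight_eq [Fintype S] [DecidableEq S] [DecidableEq A] (P : S → A → S → ℝ)
    (π : ℕ → S → A) (H N : ℕ) (s : S) (a : A) (g : S → ℝ) (l : ℝ)
    (ω : Fin N → Fin (H + 1) → S) :
    expWeight P π H N s a g l ω = Real.exp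
      (l * ∑ s', (countTrans π H N ω s a s' - countSA π H N ω s a * P s a s') * g s' -
        4 * l ^ 2 * countSA π H N ω s a) := by
  set m := ∑ z, P s a z * g z with hm
  have h1 : ∑ s', (countTrans π H N ω s a s' - countSA π H N ω s a * P s a s') * g s' =
      ∑ n : Fin N, ∑ h : Fin H,
        if ω n h.castSucc = s ∧ π h (ω n h.castSucc) = a then g (ω n h.succ) - m else 0 := by
    have h2 : (countSA π H N ω s a : ℝ) * m = ∑ n : Fin N, ∑ h : Fin H,
        if ω n h.castSucc = s ∧ π h (ω n h.castSucc) = a then m else 0 := by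
      simp only [countSA, Nat.cast_sum, sum_mul, Nat.cast_ite, Nat.cast_one, Nat.cast_zero,
        ite_mul, one_mul, zero_mul]
    simp only [sub_mul, sum_sub_distrib, mul_assoc, ← mul_sum, ← hm]
    rw [sum_countTrans_mul, h2]
    simp only [← sum_sub_distrib]
    exact sum_congr rfl fun n _ => sum_congr rfl fun h _ => by split_ifs <;> simp
  rw [h1]
  simp only [countSA, expWeight, Nat.cast_sum, mul_sum, ← sum_sub_distrib, Real.exp_sum]
  refine prod_congr rfl fun n _ => prod_congr rfl fun h _ => ?_
  unfold expStep
  split_ifs <;> simp [hm]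

/-- The `±1`-valued function with sign pattern `e`. -/
def signFun (e : S → Bool) (x : S) : ℝ := if e x then 1 else -1

lemma abs_signFun (e : S → Bool) (x : S) : |signFun e x| = 1 := by
  unfold signFun
  split_ifs <;> simp

lemma exists_sum_mul_signFun [Fintype S] (d : S → ℝ) :
    ∃ e : S → Bool, ∑ x, d x * signFun e x = ∑ x, |d x| := by
  refine ⟨fun x => decide (0 ≤ d x), sum_congr rfl fun x _ => ?_⟩
  by_cases h : 0 ≤ d x
  · simp [signFun, h, abs_of_nonneg h]
  · simp [signFun, h, abs_of_neg (not_le.1 h)]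

/-- The tilting parameter used on the event that `(s, a)` is visited `n` times. -/
noncomputable def tilt (L : ℝ) (n : ℕ) : ℝ := min (1 / 2) (Real.sqrt (L / n) / 2)

lemma tilt_nonneg (L : ℝ) (n : ℕ) : 0 ≤ tilt L n := le_min (by norm_num) (by positivity)

/-- If all tilted weights are small, the empirical kernel is close in `ℓ¹` to the truth. -/
lemma sum_abs_empKernel_sub_le [Fintype S] [DecidableEq S] [DecidableEq A]
    {P : S → A → S → ℝ} (hP : IsStochastic P) (π : ℕ → S → A) (H N : ℕ) (s : S) (a : A)
    (ω : Fin N → Fin (H + 1) → S) {L : ℝ} (hL : 0 < L) (hn : 0 < countSA π H N ω s a)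
    (hw : ∀ e : S → Bool,
      expWeight P π H N s a (signFun e) (tilt L (countSA π H N ω s a)) ω ≤ Real.exp (2 * L)) :
    ∑ s', |empKernel π H N ω s a s' - P s a s'| ≤
      6 * (Real.sqrt (L / countSA π H N ω s a) + L / countSA π H N ω s a) := by
  set n := countSA π H N ω s a with hndef
  have hn' : (0 : ℝ) < n := by exact_mod_cast hn
  set q := Real.sqrt (L / n) with hq
  have hq0 : 0 ≤ q := Real.sqrt_nonneg _
  have hq2 : q ^ 2 = L / n := Real.sq_sqrt (by positivity)
  by_cases hLn : L / n ≤ 1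
  · have hq1 : q ≤ 1 := by nlinarith
    have ht : tilt L n = q / 2 := min_eq_right (by linarith)
    obtain ⟨e, he⟩ := exists_sum_mul_signFun
      fun s' => (countTrans π H N ω s a s' : ℝ) - n * P s a s'
    have h1 := hw e
    rw [expWeight_eq, Real.exp_le_exp, ← hndef, he, ht] at h1
    have h2 : ∑ s', |(countTrans π H N ω s a s' : ℝ) - n * P s a s'| =
        n * ∑ s', |empKernel π H N ω s a s' - P s a s'| := by
      rw [mul_sum]
      refine sum_congr rfl fun s' _ => ?_
      rw [← abs_of_pos hn', ← abs_mul, abs_of_pos hn', empKernel, ← hndef]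
      congr 1
      field_simp
    rw [h2] at h1
    set D := ∑ s', |empKernel π H N ω s a s' - P s a s'|
    have hLq : L = n * q ^ 2 := by rw [hq2]; field_simp
    rw [← hq2]
    rw [hLq] at h1
    have h3 : n * (q * D) ≤ n * (6 * q ^ 2) := by nlinarith
    have h4 : q * D ≤ 6 * q ^ 2 := le_of_mul_le_mul_left h3 hn'
    have hq_pos : 0 < q := Real.sqrt_pos.2 (by positivity)
    nlinarith
  · have h1 : ∑ s', |empKernel π H N ω s a s' - P s a s'| ≤ 2 := by
      calc ∑ s', |empKernel π H N ω s a s' - P s a s'|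
          ≤ ∑ s', (empKernel π H N ω s a s' + P s a s') := by
            refine sum_le_sum fun s' _ => (abs_sub _ _).trans ?_
            rw [abs_of_nonneg (hP.1 _ _ _), abs_of_nonneg]
            unfold empKernel; positivity
        _ = 2 := by
            rw [sum_add_distrib, hP.2]
            simp only [empKernel]
            rw [← sum_div, sum_countTrans, div_self hn'.ne']
            norm_num
    push Not at hLn
    linarith

/-- Hölder's inequality against a test function with values in `[0, B]`. -/
lemma abs_sum_mul_le_of_mem_Icc [Fintype S] (d : S → ℝ) {f : S → ℝ} {B : ℝ}
    (hf : ∀ x, f x ∈ Set.Icc 0 B) : |∑ x, d x * f x| ≤ B * ∑ x, |d x| := by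
  rw [mul_sum]
  refine (abs_sum_le_sum_abs _ _).trans (sum_le_sum fun x _ => ?_)
  rw [abs_mul, abs_of_nonneg (hf x).1, mul_comm]
  exact mul_le_mul_of_nonneg_right (hf x).2 (abs_nonneg _)

lemma one_sub_le_episodesProb [Fintype S] [DecidableEq S] {P : S → A → S → ℝ}
    (hP : IsStochastic P) (π : ℕ → S → A) (s0 : S) (H N : ℕ)
    (E : Set (Fin N → Fin (H + 1) → S)) (W : (Fin N → Fin (H + 1) → S) → ℝ)
    (hW0 : ∀ ω, 0 ≤ W ω) (hW : ∀ ω, ω ∉ E → 1 ≤ W ω) :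
    1 - ∑ ω, episodesWeight P π s0 H N ω * W ω ≤ episodesProb P π s0 H N E := by
  rw [← sum_episodesWeight hP π s0 H N, ← sum_sub_distrib]
  refine sum_le_sum fun ω _ => ?_
  have hw := episodesWeight_nonneg hP π s0 H N ω
  by_cases hE : ω ∈ E
  · rw [Set.indicator_of_mem hE]
    exact sub_le_self _ (mul_nonneg hw (hW0 ω))
  · rw [Set.indicator_of_notMem hE]
    nlinarith [hW ω hE]

/-- A union bound over pairs, visit counts and sign patterns. -/
lemma episodesProb_expWeight_le [Fintype S] [DecidableEq S] [Fintype A] [DecidableEq A]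
    {P : S → A → S → ℝ} (hP : IsStochastic P) (π : ℕ → S → A) (s0 : S) (H N : ℕ) (L : ℝ) :
    1 - Fintype.card S * Fintype.card A * H * N * 2 ^ Fintype.card S * Real.exp (-(2 * L)) ≤
      episodesProb P π s0 H N
        {ω | ∀ (s : S) (a : A), 0 < countSA π H N ω s a → ∀ e : S → Bool,
          expWeight P π H N s a (signFun e) (tilt L (countSA π H N ω s a)) ω ≤
            Real.exp (2 * L)} := by
  let I : Finset ((S × A) × ℕ × (S → Bool)) := univ ×ˢ (Icc 1 (H * N) ×ˢ univ)
  let F : (S × A) × ℕ × (S → Bool) → (Fin N → Fin (H + 1) → S) → ℝ := fun i ω =>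
    Real.exp (-(2 * L)) * expWeight P π H N i.1.1 i.1.2 (signFun i.2.2) (tilt L i.2.1) ω
  have hF0 : ∀ i ω, 0 ≤ F i ω := fun i ω =>
    mul_nonneg (Real.exp_pos _).le (expWeight_nonneg _ _ _ _ _ _ _ _ _)
  refine le_trans (sub_le_sub_left ?_ 1) (one_sub_le_episodesProb hP π s0 H N _
    (fun ω => ∑ i ∈ I, F i ω) (fun ω => sum_nonneg fun i _ => hF0 i ω) ?_)
  · have hcard : (I.card : ℝ) =
        Fintype.card S * Fintype.card A * H * N * 2 ^ Fintype.card S := by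
      simp [I, card_product]
      ring
    rw [← hcard, ← nsmul_eq_mul, ← sum_const]
    simp only [mul_sum]
    rw [sum_comm]
    refine sum_le_sum fun i _ => ?_
    simp only [F, mul_left_comm _ (Real.exp (-(2 * L))), ← mul_sum]
    exact mul_le_of_le_one_right (Real.exp_pos _).le
      (sum_episodesWeight_mul_expWeight_le_one hP π s0 H N i.1.1 i.1.2
        (fun x => (abs_signFun i.2.2 x).le) (tilt_nonneg L i.2.1) (min_le_left _ _))
  · intro ω hω
    simp only [Set.mem_ofPred_eq, not_forall, not_le] at hω
    obtain ⟨s, a, hn, e, he⟩ := hω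
    have hmem : ((s, a), countSA π H N ω s a, e) ∈ I := by
      simp only [I, mem_product, mem_univ, true_and, and_true, mem_Icc]
      exact ⟨hn, countSA_le π H N ω s a⟩
    refine le_trans ?_ (single_le_sum (fun i _ => hF0 i ω) hmem)
    simp only [F]
    calc (1 : ℝ) = Real.exp (-(2 * L)) * Real.exp (2 * L) := by rw [← Real.exp_add]; simp
      _ ≤ _ := mul_le_mul_of_nonneg_left he.le (Real.exp_pos _).le

lemma episodesProb_mono [Fintype S] [DecidableEq S] {P : S → A → S → ℝ}
    (hP : IsStochastic P) (π : ℕ → S → A) (s0 : S) (H N : ℕ)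
    {E F : Set (Fin N → Fin (H + 1) → S)} (hEF : E ⊆ F) :
    episodesProb P π s0 H N E ≤ episodesProb P π s0 H N F :=
  sum_le_sum fun ω _ => Set.indicator_le_indicator_of_subset hEF
    (episodesWeight_nonneg hP π s0 H N) ω

lemma episodesProb_univ [Fintype S] [DecidableEq S] {P : S → A → S → ℝ}
    (hP : IsStochastic P) (π : ℕ → S → A) (s0 : S) (H N : ℕ) :
    episodesProb P π s0 H N Set.univ = 1 := by
  simp only [episodesProb, Set.indicator_univ]
  exact sum_episodesWeight hP π s0 H N

/-- With a single state the empirical kernel is exact. -/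
lemma empKernel_eq_of_subsingleton [Fintype S] [DecidableEq S] [DecidableEq A] [Subsingleton S]
    {P : S → A → S → ℝ} (hP : IsStochastic P) (π : ℕ → S → A) (H N : ℕ) (s : S) (a : A)
    (ω : Fin N → Fin (H + 1) → S) (hn : 0 < countSA π H N ω s a) (s' : S) :
    empKernel π H N ω s a s' = P s a s' := by
  have h1 := hP.2 s a
  have h2 := sum_countTrans π H N ω s a
  rw [Fintype.sum_subsingleton _ s'] at h1 h2
  have hn' : (countSA π H N ω s a : ℝ) ≠ 0 := by exact_mod_cast hn.ne'
  rw [empKernel, h1, h2, div_self hn']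

/-- The union bound fits in the failure budget `p` once the log factor carries `|S|`. -/
lemma union_bound_le {k : ℕ} (hk : 2 ≤ k) {X p : ℝ} (hp : 0 < p) (hX : 2 ≤ X / p) :
    X * 2 ^ k * Real.exp (-(2 * (k * Real.log (X / p)))) ≤ p := by
  set Y := X / p with hY
  have hXY : X = Y * p := by rw [hY]; field_simp
  have hY0 : 0 < Y := by linarith
  have hexp : Real.exp (-(2 * (k * Real.log Y))) = (Y ^ k * Y ^ k)⁻¹ := by
    rw [Real.exp_neg, two_mul, Real.exp_add, Real.exp_nat_mul, Real.exp_log hY0]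
  have h1 : Y ≤ Y ^ k := le_self_pow₀ (by linarith) (by omega)
  have h2 : (2 : ℝ) ^ k ≤ Y ^ k := pow_le_pow_left₀ (by norm_num) hX k
  rw [hexp, ← div_eq_mul_inv, div_le_iff₀ (by positivity), hXY]
  calc Y * p * 2 ^ k = p * (Y * 2 ^ k) := by ring
    _ ≤ p * (Y ^ k * Y ^ k) := by gcongr

/-- **dynamics estimation error bound.** There is a universal constant
`c > 0` such that with probability at least `1 − p` over `N` i.i.d. episodes of `π`,
every visited pair `(s,a)` has its empirical kernel close to the truth, uniformly over
test functions `f : S → [0,H]`. -/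
theorem dynamics_estimation_error_bound :
    ∃ c : ℝ, 0 < c ∧
      ∀ (S A : Type) [Fintype S] [DecidableEq S] [Nonempty S]
        [Fintype A] [DecidableEq A] [Nonempty A]
        (P : S → A → S → ℝ), IsStochastic P →
        ∀ (r : S → A → ℝ), (∀ s a, r s a ∈ Set.Icc (0 : ℝ) 1) →
        ∀ (π : ℕ → S → A) (s0 : S) (H N : ℕ) (p : ℝ), 0 < p → p < 1 →
        1 - p ≤ episodesProb P π s0 H N
          {ω | ∀ (s : S) (a : A), 0 < countSA π H N ω s a →
            ∀ f : S → ℝ, (∀ x, f x ∈ Set.Icc (0 : ℝ) (H : ℝ)) →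
              |∑ s' : S, (empKernel π H N ω s a s' - P s a s') * f s'| ≤
                c * (Real.sqrt (((H : ℝ) ^ 2 * (Fintype.card S) / (countSA π H N ω s a : ℝ)) *
                      Real.log ((Fintype.card S) * (Fintype.card A) * H * N / p)) +
                  ((H : ℝ) * (Fintype.card S) / (countSA π H N ω s a : ℝ)) *
                    Real.log ((Fintype.card S) * (Fintype.card A) * H * N / p))} := by
  refine ⟨6, by norm_num, ?_⟩
  intro S A _ _ _ _ _ _ P hP r _ π s0 H N p hp hp1
  rcases subsingleton_or_nontrivial S with hS | hS
  · refine (by linarith : 1 - p ≤ 1).trans ((episodesProb_univ hP π s0 H N).symm.trans_le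
      (episodesProb_mono hP π s0 H N fun ω _ s a hn f _ => ?_))
    have hcard : Fintype.card S = 1 :=
      le_antisymm (Fintype.card_le_one_iff_subsingleton.2 hS) Fintype.card_pos
    have hHN : 1 ≤ H * N := hn.trans_le (countSA_le π H N ω s a)
    have hA : 1 ≤ Fintype.card A := Fintype.card_pos
    have hX : (1 : ℝ) ≤ Fintype.card S * Fintype.card A * H * N := by
      rw [hcard]
      exact_mod_cast (by nlinarith : 1 ≤ 1 * Fintype.card A * H * N)
    have hlog : 0 ≤ Real.log (Fintype.card S * Fintype.card A * H * N / p) :=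
      Real.log_nonneg (by rw [le_div_iff₀ hp]; linarith)
    simp only [empKernel_eq_of_subsingleton hP π H N s a ω hn, sub_self, zero_mul,
      sum_const_zero, abs_zero]
    positivity
  · rcases Nat.eq_zero_or_pos (H * N) with h0 | hHN
    · refine (by linarith : 1 - p ≤ 1).trans ((episodesProb_univ hP π s0 H N).symm.trans_le
        (episodesProb_mono hP π s0 H N fun ω _ s a hn => ?_))
      exact absurd (hn.trans_le (countSA_le π H N ω s a)) (by omega)
    have hS2 : 2 ≤ Fintype.card S := Fintype.one_lt_card
    have hA : 1 ≤ Fintype.card A := Fintype.card_pos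
    have hX : (2 : ℝ) ≤ Fintype.card S * Fintype.card A * H * N := by
      have : 2 * 1 * 1 ≤ Fintype.card S * Fintype.card A * (H * N) :=
        Nat.mul_le_mul (Nat.mul_le_mul hS2 hA) hHN
      rw [← mul_assoc] at this
      exact_mod_cast this
    have hXp : (2 : ℝ) ≤ Fintype.card S * Fintype.card A * H * N / p := by
      rw [le_div_iff₀ hp]; nlinarith
    have hlog := Real.log_pos (by linarith :
      (1 : ℝ) < Fintype.card S * Fintype.card A * H * N / p)
    have hbudget := union_bound_le hS2 hp hXp
    set l := Real.log (Fintype.card S * Fintype.card A * H * N / p)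
    have hL : 0 < Fintype.card S * l := by positivity
    refine (sub_le_sub_left hbudget 1).trans ((episodesProb_expWeight_le hP π s0 H N
      (Fintype.card S * l)).trans (episodesProb_mono hP π s0 H N fun ω hω s a hn f hf => ?_))
    have hmain := sum_abs_empKernel_sub_le hP π H N s a ω hL hn (hω s a hn)
    refine (abs_sum_mul_le_of_mem_Icc _ hf).trans
      ((mul_le_mul_of_nonneg_left hmain (Nat.cast_nonneg H)).trans_eq ?_)
    have hsqrt : Real.sqrt ((H : ℝ) ^ 2 * Fintype.card S / countSA π H N ω s a * l) =
        H * Real.sqrt (Fintype.card S * l / countSA π H N ω s a) := by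
      rw [show (H : ℝ) ^ 2 * Fintype.card S / countSA π H N ω s a * l =
        (H : ℝ) ^ 2 * (Fintype.card S * l / countSA π H N ω s a) by ring,
        Real.sqrt_mul (sq_nonneg _), Real.sqrt_sq (Nat.cast_nonneg H)]
    rw [hsqrt]
    ring

end MDPform
end
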